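/- Let X₁ = X₂ = Y₁ = Y₂ = ℂ² and let ε ∈ [0,1]. If there exists a PPT measurement {P₁, P₂, P₃, P₄} on (X₁⊗X₂) : (Y₁⊗Y₂) that perfectly discriminates the four states φ_k ⊗ τ_ε (k = 1, 2, 3, 4), i.e. ⟨φ_k ⊗ τ_ε, W P_k W*⟩ = 1 for each k, then ε = 0; that is, a maximally entangled ancillary pair of qubits is required for the perfect PPT discrimination of all four Bell states. -/

import Mathlib

open Matrix Complex
open scoped Matrix Kronecker ComplexOrder

noncomputable section

/-- The tensor (Kronecker) product of two vectors. -/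
def tens {α β : Type*} (u : α → ℂ) (v : β → ℂ) : α × β → ℂ := fun p => u p.1 * v p.2

/-- The rank-one operator `u u*`. -/
def proj {α : Type*} (u : α → ℂ) : Matrix α α ℂ := Matrix.vecMulVec u (star u)

/-- A separable (positive semidefinite) operator with respect to the bipartition `α : β`. -/
def SepMat {α β : Type*} [Fintype α] [Fintype β] (P : Matrix (α × β) (α × β) ℂ) : Prop :=
  ∃ (M : ℕ) (Q : Fin M → Matrix α α ℂ) (R : Fin M → Matrix β β ℂ),
    (∀ j, (Q j).PosSemidef) ∧ (∀ j, (R j).PosSemidef) ∧ P = ∑ j, Q j ⊗ₖ R j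

/-- The operator `(1 ⊗ y)* H (1 ⊗ y)` on the first factor. -/
def blockCompress {α β : Type*} [Fintype β] (H : Matrix (α × β) (α × β) ℂ) (y : β → ℂ) :
    Matrix α α ℂ :=
  Matrix.of fun i j => ∑ a, ∑ b, star (y a) * H (i, a) (j, b) * y b

/-- Block positivity with respect to the bipartition `α : β`. -/
def BlockPositive {α β : Type*} [Fintype α] [Fintype β] (H : Matrix (α × β) (α × β) ℂ) : Prop :=
  ∀ y : β → ℂ, (blockCompress H y).PosSemidef

/-- Partial transposition on the first tensor factor. -/
def ptFst {α β : Type*} (M : Matrix (α × β) (α × β) ℂ) : Matrix (α × β) (α × β) ℂ :=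
  Matrix.of fun r c => M (c.1, r.2) (r.1, c.2)

/-- The four Bell states on two qubits. -/
def bellVec : Fin 4 → (Fin 2 × Fin 2) → ℂ :=
  ![fun p => if p.1 = p.2 then ((Real.sqrt 2 : ℂ))⁻¹ else 0,
    fun p => if p = (0, 0) then ((Real.sqrt 2 : ℂ))⁻¹
             else if p = (1, 1) then -((Real.sqrt 2 : ℂ))⁻¹ else 0,
    fun p => if p.1 ≠ p.2 then ((Real.sqrt 2 : ℂ))⁻¹ else 0,
    fun p => if p = (0, 1) then ((Real.sqrt 2 : ℂ))⁻¹
             else if p = (1, 0) then -((Real.sqrt 2 : ℂ))⁻¹ else 0]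

/-- The ancillary resource state `|τ_ε⟩ = √((1+ε)/2)|00⟩ + √((1−ε)/2)|11⟩`. -/
def tauVec (ε : ℝ) : (Fin 2 × Fin 2) → ℂ :=
  fun p => if p = (0, 0) then (Real.sqrt ((1 + ε) / 2) : ℂ)
           else if p = (1, 1) then (Real.sqrt ((1 - ε) / 2) : ℂ) else 0

/-- Conjugation by the swap unitary `W` exchanging the two middle tensor factors:
if `M` is indexed with grouping `((a₁, a₂), (b₁, b₂))`, the result is indexed with
grouping `((a₁, b₁), (a₂, b₂))`. -/
def regroup {α₁ α₂ β₁ β₂ : Type*}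
    (M : Matrix ((α₁ × α₂) × (β₁ × β₂)) ((α₁ × α₂) × (β₁ × β₂)) ℂ) :
    Matrix ((α₁ × β₁) × (α₂ × β₂)) ((α₁ × β₁) × (α₂ × β₂)) ℂ :=
  Matrix.of fun r c =>
    M ((r.1.1, r.2.1), (r.1.2, r.2.2)) ((c.1.1, c.2.1), (c.1.2, c.2.2))

/-- A PPT operator with respect to the bipartition `α : β`. -/
def PPTMat {α β : Type*} [Fintype α] [Fintype β] (P : Matrix (α × β) (α × β) ℂ) : Prop :=
  P.PosSemidef ∧ (ptFst P).PosSemidef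

open scoped MatrixOrder Matrix.Norms.L2Operator in
lemma trace_mul_nonneg_aux {n : Type*} [Fintype n] [DecidableEq n] {A B : Matrix n n ℂ}
    (hA : A.PosSemidef) (hB : B.PosSemidef) : 0 ≤ (A * B).trace := by
  obtain ⟨C, rfl⟩ := CStarAlgebra.nonneg_iff_eq_star_mul_self.mp hA.nonneg
  rw [Matrix.mul_assoc, Matrix.trace_mul_comm]
  have := hB.mul_mul_conjTranspose_same C
  exact this.trace_nonneg

lemma trace_ptFst {α β : Type*} [Fintype α] [Fintype β] (A B : Matrix (α × β) (α × β) ℂ) :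
    (ptFst A * ptFst B).trace = (A * B).trace := by
  simp only [Matrix.trace, Matrix.diag, Matrix.mul_apply, ptFst, Matrix.of_apply,
    Fintype.sum_prod_type]
  calc _ = ∑ x, ∑ z, ∑ y, ∑ w, A (z, y) (x, w) * B (x, w) (z, y) := by
        refine Finset.sum_congr rfl fun x _ => ?_
        rw [Finset.sum_comm]
    _ = ∑ z, ∑ x, ∑ y, ∑ w, A (z, y) (x, w) * B (x, w) (z, y) := Finset.sum_comm
    _ = _ := by
        refine Finset.sum_congr rfl fun x _ => ?_
        rw [Finset.sum_comm]

abbrev Q2 := Fin 2 × Fin 2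

/-- The permutation of tensor factors. -/
def sw : (Q2 × Q2) ≃ (Q2 × Q2) where
  toFun r := ((r.1.1, r.2.1), (r.1.2, r.2.2))
  invFun r := ((r.1.1, r.2.1), (r.1.2, r.2.2))
  left_inv _ := rfl
  right_inv _ := rfl

lemma regroup_eq (M : Matrix (Q2 × Q2) (Q2 × Q2) ℂ) : regroup M = M.submatrix sw sw := rfl

lemma trace_submatrix_sw (A : Matrix (Q2 × Q2) (Q2 × Q2) ℂ) :
    (A.submatrix sw sw).trace = A.trace := by
  simp only [Matrix.trace, Matrix.diag, Matrix.submatrix_apply]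
  exact Equiv.sum_comp sw (fun i => A i i)

lemma trace_regroup (A B : Matrix (Q2 × Q2) (Q2 × Q2) ℂ) :
    (regroup A * B).trace = (A * regroup B).trace := by
  rw [← trace_submatrix_sw (regroup A * B), regroup_eq, regroup_eq,
    ← Matrix.submatrix_mul_equiv _ _ _ sw]
  rfl

lemma c_sq : ((Real.sqrt 2 : ℂ))⁻¹ * ((Real.sqrt 2 : ℂ))⁻¹ = 1 / 2 := by
  rw [← mul_inv, ← Complex.ofReal_mul, Real.mul_self_sqrt (by norm_num)]
  norm_num

lemma pt_bell (k : Fin 4) :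
    ptFst (proj (bellVec (Fin.rev k))) = (1 / 2 : ℂ) • 1 - proj (bellVec k) := by
  have h := c_sq
  ext ⟨i, j⟩ ⟨i', j'⟩
  fin_cases k <;> fin_cases i <;> fin_cases j <;> fin_cases i' <;> fin_cases j' <;>
    simp [ptFst, proj, bellVec, Matrix.vecMulVec_apply, Fin.rev, Matrix.one_apply, h] <;> norm_num

lemma sum_bell : ∑ k, proj (bellVec k) = 1 := by
  have h := c_sq
  ext ⟨i, j⟩ ⟨i', j'⟩
  fin_cases i <;> fin_cases j <;> fin_cases i' <;> fin_cases j' <;>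
    simp [Fin.sum_univ_four, proj, bellVec, Matrix.vecMulVec_apply, Matrix.one_apply, h] <;>
    norm_num

lemma proj_psd {α : Type*} [Finite α] (u : α → ℂ) : (proj u).PosSemidef :=
  Matrix.posSemidef_vecMulVec_self_star u

lemma one_sub_bell_psd (k : Fin 4) : (1 - proj (bellVec k)).PosSemidef := by
  rw [← sum_bell, ← Finset.sum_erase_add _ _ (Finset.mem_univ k), add_sub_cancel_right]
  exact Matrix.posSemidef_sum _ fun j _ => proj_psd _

/-- First Schmidt coefficient. -/
def sa (ε : ℝ) : ℝ := Real.sqrt ((1 + ε) / 2)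
/-- Second Schmidt coefficient. -/
def sb (ε : ℝ) : ℝ := Real.sqrt ((1 - ε) / 2)

lemma pt_tau (ε : ℝ) : ptFst (proj (tauVec ε)) + ((sa ε * sb ε : ℝ) : ℂ) • proj (bellVec 3)
    = ((sa ε * sa ε : ℝ) : ℂ) • proj (Pi.single (0, 0) 1)
      + ((sb ε * sb ε : ℝ) : ℂ) • proj (Pi.single (1, 1) 1)
      + ((sa ε * sb ε : ℝ) : ℂ) • proj (bellVec 2) := by
  have h := c_sq
  ext ⟨i, j⟩ ⟨i', j'⟩
  fin_cases i <;> fin_cases j <;> fin_cases i' <;> fin_cases j' <;>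
    simp [ptFst, proj, bellVec, tauVec, Matrix.vecMulVec_apply, h, sa, sb, Pi.single_apply] <;>
    ring

/-- The dual witness (partially transposed). -/
def wit (ε : ℝ) (k : Fin 4) : Matrix (Q2 × Q2) (Q2 × Q2) ℂ :=
  proj (bellVec k) ⊗ₖ (ptFst (proj (tauVec ε)) + ((sa ε * sb ε : ℝ) : ℂ) • proj (bellVec 3))
    + ((sa ε * sb ε : ℝ) : ℂ) • ((1 - proj (bellVec k)) ⊗ₖ proj (bellVec 3))

lemma wit_psd (ε : ℝ) (k : Fin 4) : (wit ε k).PosSemidef := by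
  have hab : (0 : ℂ) ≤ ((sa ε * sb ε : ℝ) : ℂ) := by
    exact_mod_cast mul_nonneg (Real.sqrt_nonneg _) (Real.sqrt_nonneg _)
  have haa : (0 : ℂ) ≤ ((sa ε * sa ε : ℝ) : ℂ) := by exact_mod_cast mul_self_nonneg _
  have hbb : (0 : ℂ) ≤ ((sb ε * sb ε : ℝ) : ℂ) := by exact_mod_cast mul_self_nonneg _
  unfold wit
  rw [pt_tau]
  exact ((proj_psd _).kronecker ((((proj_psd _).smul haa).add ((proj_psd _).smul hbb)).add
    ((proj_psd _).smul hab))).add (((one_sub_bell_psd k).kronecker (proj_psd _)).smul hab)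

lemma ptFst_wit (ε : ℝ) (k : Fin 4) : ptFst (regroup (wit ε (Fin.rev k))) =
    regroup ((1 / 2 : ℂ) • (1 ⊗ₖ proj (tauVec ε)) - proj (bellVec k) ⊗ₖ proj (tauVec ε)
      + ((sa ε * sb ε : ℝ) : ℂ) • (1 ⊗ₖ ptFst (proj (bellVec 3)))) := by
  have h := pt_bell k
  ext ⟨⟨a, b⟩, ⟨c, d⟩⟩ ⟨⟨a', b'⟩, ⟨c', d'⟩⟩
  have h1 := congrFun (congrFun h (a, c)) (a', c')
  have h2 : (1 : Matrix Q2 Q2 ℂ) (a', c) (a, c') = (1 : Matrix Q2 Q2 ℂ) (a, c) (a', c') := by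
    simp only [Matrix.one_apply, Prod.mk.injEq, eq_comm]
  simp only [ptFst, Matrix.of_apply, Matrix.sub_apply, Matrix.smul_apply, smul_eq_mul] at h1
  simp only [ptFst, regroup, wit, Matrix.of_apply, Matrix.add_apply, Matrix.sub_apply,
    Matrix.smul_apply, smul_eq_mul, Matrix.kroneckerMap_apply, h1, h2]
  ring

/-- If a PPT measurement perfectly discriminates the four Bell states assisted by the resource
state `τ_ε`, then `ε = 0`: a maximally entangled ancillary pair of qubits is required. -/
theorem four_bell_perfect_ppt_requires_maximally_entangled
    (ε : ℝ) (hε : ε ∈ Set.Icc (0 : ℝ) 1)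
    (P : Fin 4 → Matrix ((Fin 2 × Fin 2) × (Fin 2 × Fin 2))
      ((Fin 2 × Fin 2) × (Fin 2 × Fin 2)) ℂ)
    (hppt : ∀ k, PPTMat (P k)) (hsum : ∑ k, P k = 1)
    (hperfect : ∀ k : Fin 4,
      ((proj (bellVec k) ⊗ₖ proj (tauVec ε)) * regroup (P k)).trace = 1) :
    ε = 0 := by
  have key : ∀ k, 0 ≤ ((1 / 2 : ℂ) * (((1 : Matrix Q2 Q2 ℂ) ⊗ₖ proj (tauVec ε)) *
      regroup (P k)).trace - 1 + ((sa ε * sb ε : ℝ) : ℂ) *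
        (((1 : Matrix Q2 Q2 ℂ) ⊗ₖ ptFst (proj (bellVec 3))) * regroup (P k)).trace) := by
    intro k
    have h1 : (regroup (wit ε (Fin.rev k))).PosSemidef := by
      rw [regroup_eq]; exact (wit_psd _ _).submatrix sw
    have h2 := trace_mul_nonneg_aux h1 (hppt k).2
    rw [← trace_ptFst, ptFst_wit] at h2
    change 0 ≤ (regroup _ * P k).trace at h2
    rw [trace_regroup] at h2
    simpa only [Matrix.add_mul, Matrix.sub_mul, Matrix.smul_mul, Matrix.trace_add,
      Matrix.trace_sub, Matrix.trace_smul, smul_eq_mul, hperfect k] using h2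
  have hs : ∑ k, regroup (P k) = 1 := by
    have : ∑ k, regroup (P k) = regroup (∑ k, P k) := by
      ext r c; simp [regroup, Matrix.sum_apply]
    rw [this, hsum, regroup_eq, Matrix.submatrix_one_equiv]
  have hS : ∀ A : Matrix (Q2 × Q2) (Q2 × Q2) ℂ, ∑ k, (A * regroup (P k)).trace = A.trace := by
    intro A
    rw [← Matrix.trace_sum, ← Matrix.mul_sum, hs, Matrix.mul_one]
  have tot := Finset.sum_nonneg fun k (_ : k ∈ Finset.univ) => key k
  rw [Finset.sum_add_distrib, Finset.sum_sub_distrib, ← Finset.mul_sum, ← Finset.mul_sum, hS, hS,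
    Matrix.trace_kronecker, Matrix.trace_kronecker] at tot
  obtain ⟨h0, h1⟩ := hε
  have ha : sa ε * sa ε = (1 + ε) / 2 := Real.mul_self_sqrt (by linarith)
  have hb : sb ε * sb ε = (1 - ε) / 2 := Real.mul_self_sqrt (by linarith)
  have ht1 : (proj (tauVec ε)).trace = 1 := by
    have : (proj (tauVec ε)).trace = ((sa ε * sa ε + sb ε * sb ε : ℝ) : ℂ) := by
      simp [Matrix.trace, proj, Matrix.vecMulVec_apply, tauVec, Fintype.sum_prod_type, sa, sb]
    rw [this, ha, hb]; push_cast; ring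
  have ht2 : (ptFst (proj (bellVec 3))).trace = 1 := by
    have h := c_sq
    simp [Matrix.trace, proj, Matrix.vecMulVec_apply, bellVec, Fintype.sum_prod_type, ptFst, h]
    norm_num
  rw [ht1, ht2] at tot
  have tot' : (0 : ℂ) ≤ ((4 * (sa ε * sb ε) - 2 : ℝ) : ℂ) := by
    convert tot using 1
    simp [Matrix.trace_one]; ring
  have t3 : (0 : ℝ) ≤ 4 * (sa ε * sb ε) - 2 := by exact_mod_cast tot'
  have t4 : sa ε - sb ε = 0 := by
    have : (sa ε - sb ε) ^ 2 ≤ 0 := by nlinarith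
    exact pow_eq_zero_iff (two_ne_zero) |>.mp (le_antisymm this (sq_nonneg _))
  have t5 : sa ε = sb ε := by linarith
  rw [t5] at ha
  linarith
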